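/- Let O be an LTL_horn^□○ ontology and let s_O, p_O be positive integers such that, for every data instance A consistent with O, τ_{O,A}(n) = τ_{O,A}(n − p_O) for all n ≤ min A − s_O and τ_{O,A}(n) = τ_{O,A}(n + p_O) for all n ≥ max A + s_O. Then for every data instance A consistent with O and every positive temporal concept κ: n ∈ κ^{C_{O,A}} iff n + p_O ∈ κ^{C_{O,A}}, for all n ≥ max A + s_O + l_κ·p_O; and n ∈ κ^{C_{O,A}} iff n − p_O ∈ κ^{C_{O,A}}, for all n ≤ min A − (s_O + l_κ·p_O), where l_κ is the number of temporal operators occurring in κ. -/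

import Mathlib

namespace LTLOMQ

/-! ## Temporal concepts (LTL formulas) and their semantics over (ℤ,<) -/

/-- Temporal concepts: arbitrary LTL formulas over atomic concepts indexed by `ℕ`. -/
inductive TC : Type where
  | top : TC
  | atom : ℕ → TC
  | neg : TC → TC
  | and : TC → TC → TC
  | or : TC → TC → TC
  | nextF : TC → TC
  | diamF : TC → TC
  | boxF : TC → TC
  | untl : TC → TC → TC
  | nextP : TC → TC
  | diamP : TC → TC
  | boxP : TC → TC
  | since : TC → TC → TC

/-- A temporal interpretation assigns to each atomic concept a subset of ℤ. -/
abbrev Itp : Type := ℕ → Set ℤ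

/-- The extension of a temporal concept in an interpretation
(strict semantics over `(ℤ,<)`). -/
def TC.sem (M : Itp) : TC → Set ℤ
  | .top => Set.univ
  | .atom a => M a
  | .neg C => (TC.sem M C)ᶜ
  | .and C D => TC.sem M C ∩ TC.sem M D
  | .or C D => TC.sem M C ∪ TC.sem M D
  | .nextF C => {n | n + 1 ∈ TC.sem M C}
  | .diamF C => {n | ∃ k, n < k ∧ k ∈ TC.sem M C}
  | .boxF C => {n | ∀ k, n < k → k ∈ TC.sem M C}
  | .untl C D => {n | ∃ k, n < k ∧ k ∈ TC.sem M D ∧ ∀ m, n < m → m < k → m ∈ TC.sem M C}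
  | .nextP C => {n | n - 1 ∈ TC.sem M C}
  | .diamP C => {n | ∃ k, k < n ∧ k ∈ TC.sem M C}
  | .boxP C => {n | ∀ k, k < n → k ∈ TC.sem M C}
  | .since C D => {n | ∃ k, k < n ∧ k ∈ TC.sem M D ∧ ∀ m, k < m → m < n → m ∈ TC.sem M C}

/-- Basic temporal concepts: built from atomic concepts using ○F, ○P, □F, □P. -/
inductive TC.IsBasic : TC → Prop
  | atom (a : ℕ) : TC.IsBasic (.atom a)
  | nextF {C : TC} : TC.IsBasic C → TC.IsBasic (.nextF C)
  | nextP {C : TC} : TC.IsBasic C → TC.IsBasic (.nextP C)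
  | boxF {C : TC} : TC.IsBasic C → TC.IsBasic (.boxF C)
  | boxP {C : TC} : TC.IsBasic C → TC.IsBasic (.boxP C)

/-- Basic temporal concepts using □F and □P only. -/
inductive TC.IsBasicBox : TC → Prop
  | atom (a : ℕ) : TC.IsBasicBox (.atom a)
  | boxF {C : TC} : TC.IsBasicBox C → TC.IsBasicBox (.boxF C)
  | boxP {C : TC} : TC.IsBasicBox C → TC.IsBasicBox (.boxP C)

/-- Basic temporal concepts using ○F and ○P only. -/
inductive TC.IsBasicNext : TC → Prop
  | atom (a : ℕ) : TC.IsBasicNext (.atom a)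
  | nextF {C : TC} : TC.IsBasicNext C → TC.IsBasicNext (.nextF C)
  | nextP {C : TC} : TC.IsBasicNext C → TC.IsBasicNext (.nextP C)

/-- Positive temporal concepts: no occurrences of ¬. -/
inductive TC.IsPositive : TC → Prop
  | top : TC.IsPositive .top
  | atom (a : ℕ) : TC.IsPositive (.atom a)
  | and {C D : TC} : TC.IsPositive C → TC.IsPositive D → TC.IsPositive (.and C D)
  | or {C D : TC} : TC.IsPositive C → TC.IsPositive D → TC.IsPositive (.or C D)
  | nextF {C : TC} : TC.IsPositive C → TC.IsPositive (.nextF C)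
  | diamF {C : TC} : TC.IsPositive C → TC.IsPositive (.diamF C)
  | boxF {C : TC} : TC.IsPositive C → TC.IsPositive (.boxF C)
  | untl {C D : TC} : TC.IsPositive C → TC.IsPositive D → TC.IsPositive (.untl C D)
  | nextP {C : TC} : TC.IsPositive C → TC.IsPositive (.nextP C)
  | diamP {C : TC} : TC.IsPositive C → TC.IsPositive (.diamP C)
  | boxP {C : TC} : TC.IsPositive C → TC.IsPositive (.boxP C)
  | since {C D : TC} : TC.IsPositive C → TC.IsPositive D → TC.IsPositive (.since C D)

/-- Prior-LTL formulas: Boolean connectives and □P, ◇P, □F, ◇F only. -/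
inductive TC.IsPrior : TC → Prop
  | atom (a : ℕ) : TC.IsPrior (.atom a)
  | neg {C : TC} : TC.IsPrior C → TC.IsPrior (.neg C)
  | and {C D : TC} : TC.IsPrior C → TC.IsPrior D → TC.IsPrior (.and C D)
  | or {C D : TC} : TC.IsPrior C → TC.IsPrior D → TC.IsPrior (.or C D)
  | boxF {C : TC} : TC.IsPrior C → TC.IsPrior (.boxF C)
  | boxP {C : TC} : TC.IsPrior C → TC.IsPrior (.boxP C)
  | diamF {C : TC} : TC.IsPrior C → TC.IsPrior (.diamF C)
  | diamP {C : TC} : TC.IsPrior C → TC.IsPrior (.diamP C)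

/-- Number of occurrences of temporal operators in a temporal concept. -/
def TC.tempOps : TC → ℕ
  | .top => 0
  | .atom _ => 0
  | .neg C => TC.tempOps C
  | .and C D => TC.tempOps C + TC.tempOps D
  | .or C D => TC.tempOps C + TC.tempOps D
  | .nextF C => TC.tempOps C + 1
  | .diamF C => TC.tempOps C + 1
  | .boxF C => TC.tempOps C + 1
  | .untl C D => TC.tempOps C + TC.tempOps D + 1
  | .nextP C => TC.tempOps C + 1
  | .diamP C => TC.tempOps C + 1
  | .boxP C => TC.tempOps C + 1
  | .since C D => TC.tempOps C + TC.tempOps D + 1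

/-- Number of occurrences of symbols in a temporal concept. -/
def TC.size : TC → ℕ
  | .top => 1
  | .atom _ => 1
  | .neg C => TC.size C + 1
  | .and C D => TC.size C + TC.size D + 1
  | .or C D => TC.size C + TC.size D + 1
  | .nextF C => TC.size C + 1
  | .diamF C => TC.size C + 1
  | .boxF C => TC.size C + 1
  | .untl C D => TC.size C + TC.size D + 1
  | .nextP C => TC.size C + 1
  | .diamP C => TC.size C + 1
  | .boxP C => TC.size C + 1
  | .since C D => TC.size C + TC.size D + 1

/-- The set of subconcepts of a temporal concept. -/
def TC.subs : TC → Set TC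
  | .top => {.top}
  | .atom a => {.atom a}
  | .neg C => insert (.neg C) (TC.subs C)
  | .and C D => insert (.and C D) (TC.subs C ∪ TC.subs D)
  | .or C D => insert (.or C D) (TC.subs C ∪ TC.subs D)
  | .nextF C => insert (.nextF C) (TC.subs C)
  | .diamF C => insert (.diamF C) (TC.subs C)
  | .boxF C => insert (.boxF C) (TC.subs C)
  | .untl C D => insert (.untl C D) (TC.subs C ∪ TC.subs D)
  | .nextP C => insert (.nextP C) (TC.subs C)
  | .diamP C => insert (.diamP C) (TC.subs C)
  | .boxP C => insert (.boxP C) (TC.subs C)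
  | .since C D => insert (.since C D) (TC.subs C ∪ TC.subs D)

/-- The set of atomic concepts occurring in a temporal concept. -/
def TC.atoms : TC → Set ℕ
  | .top => ∅
  | .atom a => {a}
  | .neg C => TC.atoms C
  | .and C D => TC.atoms C ∪ TC.atoms D
  | .or C D => TC.atoms C ∪ TC.atoms D
  | .nextF C => TC.atoms C
  | .diamF C => TC.atoms C
  | .boxF C => TC.atoms C
  | .untl C D => TC.atoms C ∪ TC.atoms D
  | .nextP C => TC.atoms C
  | .diamP C => TC.atoms C
  | .boxP C => TC.atoms C
  | .since C D => TC.atoms C ∪ TC.atoms D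

/-! ## Clauses, ontologies, data instances -/

/-- A clause `C₁ ∧ … ∧ C_k → C_{k+1} ∨ … ∨ C_{k+m}`. -/
structure Clause : Type where
  prem : List TC
  concl : List TC

/-- A clause is true in `M` if the intersection of the extensions of the premises
is contained in the union of the extensions of the conclusions. -/
def Clause.holds (M : Itp) (cl : Clause) : Prop :=
  ∀ n : ℤ, (∀ C ∈ cl.prem, n ∈ TC.sem M C) → ∃ C ∈ cl.concl, n ∈ TC.sem M C

/-- An ontology is a finite set (list) of clauses. -/
abbrev Ontology : Type := List Clause

def Clause.AllBasic (cl : Clause) : Prop :=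
  (∀ C ∈ cl.prem, C.IsBasic) ∧ (∀ C ∈ cl.concl, C.IsBasic)

def Clause.AllBasicBox (cl : Clause) : Prop :=
  (∀ C ∈ cl.prem, C.IsBasicBox) ∧ (∀ C ∈ cl.concl, C.IsBasicBox)

def Clause.AllBasicNext (cl : Clause) : Prop :=
  (∀ C ∈ cl.prem, C.IsBasicNext) ∧ (∀ C ∈ cl.concl, C.IsBasicNext)

/-- Horn: at most one disjunct in the conclusion. -/
def Clause.Horn (cl : Clause) : Prop := cl.concl.length ≤ 1

/-- Krom (binary): at most two concepts altogether. -/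
def Clause.Krom (cl : Clause) : Prop := cl.prem.length + cl.concl.length ≤ 2

/-- LTL_bool^□○ ontologies. -/
def Ontology.BoolBoxNext (O : Ontology) : Prop := ∀ cl ∈ O, cl.AllBasic
/-- LTL_bool^□ ontologies. -/
def Ontology.BoolBox (O : Ontology) : Prop := ∀ cl ∈ O, cl.AllBasicBox
/-- LTL_krom^○ ontologies. -/
def Ontology.KromNext (O : Ontology) : Prop := ∀ cl ∈ O, cl.AllBasicNext ∧ cl.Krom
/-- LTL_krom^□○ ontologies. -/
def Ontology.KromBoxNext (O : Ontology) : Prop := ∀ cl ∈ O, cl.AllBasic ∧ cl.Krom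
/-- LTL_horn^□○ ontologies. -/
def Ontology.HornBoxNext (O : Ontology) : Prop := ∀ cl ∈ O, cl.AllBasic ∧ cl.Horn
/-- LTL_horn^□ ontologies. -/
def Ontology.HornBox (O : Ontology) : Prop := ∀ cl ∈ O, cl.AllBasicBox ∧ cl.Horn
/-- LTL_core^□○ ontologies. -/
def Ontology.CoreBoxNext (O : Ontology) : Prop := ∀ cl ∈ O, cl.AllBasic ∧ cl.Horn ∧ cl.Krom

/-- Number of occurrences of symbols in a clause. -/
def Clause.size (cl : Clause) : ℕ :=
  (cl.prem.map TC.size).sum + (cl.concl.map TC.size).sum + 1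

/-- Number of occurrences of symbols in an ontology. -/
def Ontology.size (O : Ontology) : ℕ := (O.map Clause.size).sum

/-- The atomic concept `a` occurs in the ontology `O`. -/
def Ontology.occurs (O : Ontology) (a : ℕ) : Prop :=
  ∃ cl ∈ O, (∃ C ∈ cl.prem, a ∈ C.atoms) ∨ (∃ C ∈ cl.concl, a ∈ C.atoms)

/-- The set of subconcepts of (concepts occurring in) an ontology. -/
def Ontology.subs (O : Ontology) : Set TC :=
  {C | ∃ cl ∈ O, ∃ D : TC, (D ∈ cl.prem ∨ D ∈ cl.concl) ∧ C ∈ D.subs}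

/-- A flat concept: an atomic concept, or a single ○F or ○P applied to an atomic concept. -/
def TC.IsFlat : TC → Prop
  | .atom _ => True
  | .nextF (.atom _) => True
  | .nextP (.atom _) => True
  | _ => False

/-- An ontology without nested temporal operators. -/
def Ontology.Flat (O : Ontology) : Prop :=
  ∀ cl ∈ O, (∀ C ∈ cl.prem, C.IsFlat) ∧ (∀ C ∈ cl.concl, C.IsFlat)

/-- A data instance: a finite nonempty set of timestamped atoms, normalized so that
the minimal timestamp is 0 and the maximal one is ≥ 1. -/
structure DataInstance : Type where
  atoms : Finset (ℕ × ℤ)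
  nonneg : ∀ p ∈ atoms, 0 ≤ p.2
  has_zero : ∃ p ∈ atoms, p.2 = 0
  has_one : ∃ p ∈ atoms, 1 ≤ p.2

theorem DataInstance.ts_nonempty (A : DataInstance) :
    (A.atoms.image Prod.snd).Nonempty := by
  obtain ⟨p, hp, -⟩ := A.has_zero
  exact ⟨p.2, Finset.mem_image_of_mem _ hp⟩

/-- min A: the minimal timestamp occurring in the data instance (equal to 0). -/
def DataInstance.minT (A : DataInstance) : ℤ :=
  (A.atoms.image Prod.snd).min' A.ts_nonempty

/-- max A: the maximal timestamp occurring in the data instance. -/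
def DataInstance.maxT (A : DataInstance) : ℤ :=
  (A.atoms.image Prod.snd).max' A.ts_nonempty

/-- The active temporal domain tem(A). -/
def DataInstance.tem (A : DataInstance) : Set ℤ := Set.Icc A.minT A.maxT

/-- The interpretation of atomic concepts in the first-order structure S_A. -/
def DataInstance.itp (A : DataInstance) : Itp := fun a => {n | (a, n) ∈ A.atoms}

/-- `M` is a model of the knowledge base `(O, A)`. -/
def IsModel (M : Itp) (O : Ontology) (A : DataInstance) : Prop :=
  (∀ cl ∈ O, cl.holds M) ∧ ∀ p ∈ A.atoms, p.2 ∈ M p.1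

/-- The ontology `O` is consistent. -/
def Ontology.Consistent (O : Ontology) : Prop := ∃ M : Itp, ∀ cl ∈ O, cl.holds M

/-- The data instance `A` is consistent with `O`. -/
def ConsistentWith (O : Ontology) (A : DataInstance) : Prop := ∃ M : Itp, IsModel M O A

/-- Certain answers to the OMIQ `(O, κ)` over `A` (within the active domain). -/
def certAns (O : Ontology) (κ : TC) (A : DataInstance) : Set ℤ :=
  {ℓ | ℓ ∈ A.tem ∧ ∀ M : Itp, IsModel M O A → ℓ ∈ TC.sem M κ}

/-- Certain answers to the OMIQ `(O, κ)` over `A` and ℤ. -/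
def certAnsZ (O : Ontology) (κ : TC) (A : DataInstance) : Set ℤ :=
  {ℓ | ∀ M : Itp, IsModel M O A → ℓ ∈ TC.sem M κ}

/-! ## First-order, MSO and FO(RPR) formulas over the temporal structures -/

/-- Formulas of the target languages: first-order variables are indexed by `ℕ`,
as are second-order (set) variables and the recursively defined relation variables
of FO(RPR).  The constructors `qprev j` and `qapp j x` stand for `Q_j(t-1)` (inside
a recursive definition block) and `Q_j(x)`, respectively; `rpr n Θ tv ψ` is the
relational-primitive-recursion construct `[Q₁(t) ≡ Θ₁; …; Q_n(t) ≡ Θ_n] ψ`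
with recursion variable `tv`. -/
inductive Fml : Type where
  | falsum : Fml
  | atom : ℕ → ℕ → Fml        -- A(x)
  | lt : ℕ → ℕ → Fml          -- x < y
  | eq : ℕ → ℕ → Fml          -- x = y
  | succ : ℕ → ℕ → Fml        -- x = y + 1
  | mod : ℕ → ℕ → Fml         -- x ≡ 0 (mod n)
  | svar : ℕ → ℕ → Fml        -- X(x), X a set variable
  | qprev : ℕ → Fml           -- Q_j(t−1)
  | qapp : ℕ → ℕ → Fml        -- Q_j(x)
  | neg : Fml → Fml
  | and : Fml → Fml → Fml
  | or : Fml → Fml → Fml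
  | ex : ℕ → Fml → Fml
  | all : ℕ → Fml → Fml
  | exS : ℕ → Fml → Fml       -- second-order ∃
  | allS : ℕ → Fml → Fml      -- second-order ∀
  | rpr : (n : ℕ) → (Fin n → Fml) → ℕ → Fml → Fml

/-- Evaluation of a formula over the structure with (active) domain `D ⊆ ℤ`
and interpretation `I` of the unary predicates; `env` assigns first-order
variables, `senv` set variables, `prev` the placeholders `Q_j(t-1)` and
`Q` the defined relation variables. First-order quantifiers range over `D`,
second-order quantifiers over subsets of `D`. -/
def Fml.eval (D : Set ℤ) (I : ℕ → Set ℤ) :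
    Fml → (ℕ → ℤ) → (ℕ → Set ℤ) → (ℕ → Prop) → (ℕ → ℤ → Prop) → Prop
  | .falsum, _, _, _, _ => False
  | .atom a x, env, _, _, _ => env x ∈ I a
  | .lt x y, env, _, _, _ => env x < env y
  | .eq x y, env, _, _, _ => env x = env y
  | .succ x y, env, _, _, _ => env x = env y + 1
  | .mod n x, env, _, _, _ => (n : ℤ) ∣ env x
  | .svar X x, env, senv, _, _ => env x ∈ senv X
  | .qprev j, _, _, prev, _ => prev j
  | .qapp j x, env, _, _, Q => Q j (env x)
  | .neg φ, env, senv, prev, Q => ¬ Fml.eval D I φ env senv prev Q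
  | .and φ ψ, env, senv, prev, Q =>
      Fml.eval D I φ env senv prev Q ∧ Fml.eval D I ψ env senv prev Q
  | .or φ ψ, env, senv, prev, Q =>
      Fml.eval D I φ env senv prev Q ∨ Fml.eval D I ψ env senv prev Q
  | .ex x φ, env, senv, prev, Q =>
      ∃ d ∈ D, Fml.eval D I φ (Function.update env x d) senv prev Q
  | .all x φ, env, senv, prev, Q =>
      ∀ d ∈ D, Fml.eval D I φ (Function.update env x d) senv prev Q
  | .exS X φ, env, senv, prev, Q =>
      ∃ S : Set ℤ, S ⊆ D ∧ Fml.eval D I φ env (Function.update senv X S) prev Q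
  | .allS X φ, env, senv, prev, Q =>
      ∀ S : Set ℤ, S ⊆ D → Fml.eval D I φ env (Function.update senv X S) prev Q
  | .rpr n Θ tv ψ, env, senv, prev, Q =>
      -- the semantics of each Θ_j, as a function of the first-order environment
      -- and of the truth values of the `Q_j(t−1)` placeholders
      let f : Fin n → (ℕ → ℤ) → (ℕ → Prop) → Prop :=
        fun j env' prev' => Fml.eval D I (Θ j) env' senv prev' Q
      -- the recursively computed truth values of `Q_j` at time `k` (recursion on k from 0)
      let recQ : ℕ → Fin n → Prop := fun k =>
        Nat.rec (fun j => f j (Function.update env tv 0) (fun _ => False))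
          (fun m ih j => f j (Function.update env tv ((m : ℤ) + 1))
            (fun i => ∃ h : i < n, ih ⟨i, h⟩)) k
      Fml.eval D I ψ env senv prev
        (fun j z => ∃ h : j < n, 0 ≤ z ∧ recQ z.toNat ⟨j, h⟩)

/-- Free first-order variables of a formula. -/
def Fml.fvars : Fml → Set ℕ
  | .falsum => ∅
  | .atom _ x => {x}
  | .lt x y => {x, y}
  | .eq x y => {x, y}
  | .succ x y => {x, y}
  | .mod _ x => {x}
  | .svar _ x => {x}
  | .qprev _ => ∅
  | .qapp _ x => {x}
  | .neg φ => Fml.fvars φ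
  | .and φ ψ => Fml.fvars φ ∪ Fml.fvars ψ
  | .or φ ψ => Fml.fvars φ ∪ Fml.fvars ψ
  | .ex x φ => Fml.fvars φ \ {x}
  | .all x φ => Fml.fvars φ \ {x}
  | .exS _ φ => Fml.fvars φ
  | .allS _ φ => Fml.fvars φ
  | .rpr n Θ tv ψ => (⋃ j : Fin n, Fml.fvars (Θ j) \ {tv}) ∪ Fml.fvars ψ

/-- FO(<)-formulas: first-order logic with the built-in linear order
(and the definable equality predicate); no constants, no arithmetic. -/
def Fml.IsFOlt : Fml → Prop
  | .falsum => True
  | .atom _ _ => True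
  | .lt _ _ => True
  | .eq _ _ => True
  | .neg φ => Fml.IsFOlt φ
  | .and φ ψ => Fml.IsFOlt φ ∧ Fml.IsFOlt ψ
  | .or φ ψ => Fml.IsFOlt φ ∧ Fml.IsFOlt ψ
  | .ex _ φ => Fml.IsFOlt φ
  | .all _ φ => Fml.IsFOlt φ
  | _ => False

/-- FO(<,≡)-formulas: FO(<) extended with the predicates `t ≡ 0 (mod n)`, `n > 1`. -/
def Fml.IsFOltMod : Fml → Prop
  | .falsum => True
  | .atom _ _ => True
  | .lt _ _ => True
  | .eq _ _ => True
  | .mod n _ => 2 ≤ n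
  | .neg φ => Fml.IsFOltMod φ
  | .and φ ψ => Fml.IsFOltMod φ ∧ Fml.IsFOltMod ψ
  | .or φ ψ => Fml.IsFOltMod φ ∧ Fml.IsFOltMod ψ
  | .ex _ φ => Fml.IsFOltMod φ
  | .all _ φ => Fml.IsFOltMod φ
  | _ => False

/-- MSO(<)-formulas: FO(<) extended with set variables and second-order quantifiers. -/
def Fml.IsMSO : Fml → Prop
  | .falsum => True
  | .atom _ _ => True
  | .lt _ _ => True
  | .eq _ _ => True
  | .svar _ _ => True
  | .neg φ => Fml.IsMSO φ
  | .and φ ψ => Fml.IsMSO φ ∧ Fml.IsMSO ψ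
  | .or φ ψ => Fml.IsMSO φ ∧ Fml.IsMSO ψ
  | .ex _ φ => Fml.IsMSO φ
  | .all _ φ => Fml.IsMSO φ
  | .exS _ φ => Fml.IsMSO φ
  | .allS _ φ => Fml.IsMSO φ
  | _ => False

/-- FO(RPR)-formulas: FO(<) extended with successor and relational primitive recursion. -/
def Fml.IsRPR : Fml → Prop
  | .falsum => True
  | .atom _ _ => True
  | .lt _ _ => True
  | .eq _ _ => True
  | .succ _ _ => True
  | .qprev _ => True
  | .qapp _ _ => True
  | .neg φ => Fml.IsRPR φ
  | .and φ ψ => Fml.IsRPR φ ∧ Fml.IsRPR ψ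
  | .or φ ψ => Fml.IsRPR φ ∧ Fml.IsRPR ψ
  | .ex _ φ => Fml.IsRPR φ
  | .all _ φ => Fml.IsRPR φ
  | .rpr n Θ _ ψ => (∀ j : Fin n, Fml.IsRPR (Θ j)) ∧ Fml.IsRPR ψ
  | _ => False

/-- MFO(<)-formulas: monadic first-order formulas built from atoms `A(t)`,
`t < t'`, `t = t'` and `t = t' + 1`. -/
def Fml.IsMFO : Fml → Prop
  | .falsum => True
  | .atom _ _ => True
  | .lt _ _ => True
  | .eq _ _ => True
  | .succ _ _ => True
  | .neg φ => Fml.IsMFO φ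
  | .and φ ψ => Fml.IsMFO φ ∧ Fml.IsMFO ψ
  | .or φ ψ => Fml.IsMFO φ ∧ Fml.IsMFO ψ
  | .ex _ φ => Fml.IsMFO φ
  | .all _ φ => Fml.IsMFO φ
  | _ => False

/-- Quasi-positive MFO(<)-formulas: built from atoms `A(t)`, `t < t'`, `t = t'`,
`t = t' + 1` (and ⊥) using ∧, ∨, ∃, ∀ as well as guarded universal quantification
`∀y (x < y < z → φ)`, `∀y (x < y → φ)`, `∀y (y < z → φ)`
(the guarded implications are encoded via `¬guard ∨ φ`). -/
inductive Fml.IsQP : Fml → Prop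
  | falsum : Fml.IsQP .falsum
  | atom (a x : ℕ) : Fml.IsQP (.atom a x)
  | lt (x y : ℕ) : Fml.IsQP (.lt x y)
  | eq (x y : ℕ) : Fml.IsQP (.eq x y)
  | succ (x y : ℕ) : Fml.IsQP (.succ x y)
  | and {φ ψ : Fml} : Fml.IsQP φ → Fml.IsQP ψ → Fml.IsQP (.and φ ψ)
  | or {φ ψ : Fml} : Fml.IsQP φ → Fml.IsQP ψ → Fml.IsQP (.or φ ψ)
  | ex (x : ℕ) {φ : Fml} : Fml.IsQP φ → Fml.IsQP (.ex x φ)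
  | all (x : ℕ) {φ : Fml} : Fml.IsQP φ → Fml.IsQP (.all x φ)
  | allBtw (y x z : ℕ) {φ : Fml} : Fml.IsQP φ →
      Fml.IsQP (.all y (.or (.neg (.and (.lt x y) (.lt y z))) φ))
  | allGt (y x : ℕ) {φ : Fml} : Fml.IsQP φ →
      Fml.IsQP (.all y (.or (.neg (.lt x y)) φ))
  | allLt (y z : ℕ) {φ : Fml} : Fml.IsQP φ →
      Fml.IsQP (.all y (.or (.neg (.lt y z)) φ))

/-- Evaluation in a structure with domain `D` and unary predicates `I`
(no set variables, placeholders or relation variables supplied). -/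
def Fml.evalIn (D : Set ℤ) (I : Itp) (φ : Fml) (env : ℕ → ℤ) : Prop :=
  Fml.eval D I φ env (fun _ => ∅) (fun _ => False) (fun _ _ => False)

/-- An MFO(<)-formula is monotone if it is preserved under adding time points
to the extensions of the atomic concepts. -/
def MonotoneFml (ψ : Fml) : Prop :=
  ∀ M₁ M₂ : Itp, (∀ a : ℕ, M₁ a ⊆ M₂ a) → ∀ env : ℕ → ℤ,
    Fml.evalIn Set.univ M₁ ψ env → Fml.evalIn Set.univ M₂ ψ env

/-! ## The canonical model of a Horn ontology and a data instance -/

/-- Atoms of the closure: ⊥ or `C(n)` for a (basic) temporal concept `C` and `n ∈ ℤ`. -/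
inductive EAtom : Type where
  | bot : EAtom
  | conc : TC → ℤ → EAtom

/-- One (non-recursive) application of the closure rules of the canonical model. -/
def clStep (O : Ontology) (Λ : Set EAtom) : Set EAtom :=
  Λ ∪
  {e | ∃ cl ∈ O, ∃ n : ℤ, (∀ C ∈ cl.prem, EAtom.conc C n ∈ Λ) ∧
        ((∃ C : TC, cl.concl = [C] ∧ e = EAtom.conc C n) ∨
          (cl.concl = [] ∧ e = EAtom.bot))} ∪
  {e | ∃ C : TC, ∃ n k : ℤ, n < k ∧ EAtom.conc (.boxF C) n ∈ Λ ∧ e = EAtom.conc C k} ∪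
  {e | ∃ C : TC, ∃ n : ℤ, (∀ k : ℤ, n < k → EAtom.conc C k ∈ Λ) ∧
        e = EAtom.conc (.boxF C) n} ∪
  {e | ∃ C : TC, ∃ n : ℤ, EAtom.conc (.nextF C) n ∈ Λ ∧ e = EAtom.conc C (n + 1)} ∪
  {e | ∃ C : TC, ∃ n : ℤ, EAtom.conc C (n + 1) ∈ Λ ∧ e = EAtom.conc (.nextF C) n} ∪
  {e | ∃ C : TC, ∃ n k : ℤ, k < n ∧ EAtom.conc (.boxP C) n ∈ Λ ∧ e = EAtom.conc C k} ∪
  {e | ∃ C : TC, ∃ n : ℤ, (∀ k : ℤ, k < n → EAtom.conc C k ∈ Λ) ∧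
        e = EAtom.conc (.boxP C) n} ∪
  {e | ∃ C : TC, ∃ n : ℤ, EAtom.conc (.nextP C) n ∈ Λ ∧ e = EAtom.conc C (n - 1)} ∪
  {e | ∃ C : TC, ∃ n : ℤ, EAtom.conc C (n - 1) ∈ Λ ∧ e = EAtom.conc (.nextP C) n}

/-- Transfinite iteration of the closure rules. -/
noncomputable def clIter (O : Ontology) (Λ : Set EAtom) (o : Ordinal.{0}) : Set EAtom :=
  Ordinal.limitRecOn o Λ (fun _ ih => clStep O ih)
    (fun o _ ih => ⋃ (o' : Ordinal.{0}), ⋃ (h : o' < o), ih o' h)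

/-- The atoms of a data instance, as a set of closure atoms. -/
def dataAtoms (A : DataInstance) : Set EAtom :=
  {e | ∃ p ∈ A.atoms, e = EAtom.conc (.atom p.1) p.2}

open Ordinal in
/-- The canonical model `C_{O,A}`: the closure of `A` under the rules,
iterated up to the first uncountable ordinal ω₁. -/
noncomputable def canon (O : Ontology) (A : DataInstance) : Set EAtom :=
  clIter O (dataAtoms A) (Ordinal.omega 1)

/-- The canonical model regarded as a temporal interpretation. -/
noncomputable def canonItp (O : Ontology) (A : DataInstance) : Itp :=
  fun a => {n | EAtom.conc (.atom a) n ∈ canon O A}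

/-- The type `τ_{O,A}(n)`: the set of subconcepts of `O` that hold at `n`
in the canonical model. -/
noncomputable def tau (O : Ontology) (A : DataInstance) (n : ℤ) : Set TC :=
  {C ∈ O.subs | n ∈ TC.sem (canonItp O A) C}

/-! ## Literals and the reachability relation ⇝ for Krom ontologies -/

/-- A simple literal: an atomic concept with a polarity. -/
abbrev Lit : Type := ℕ × Bool

/-- The temporal concept corresponding to a literal. -/
def Lit.toTC (L : Lit) : TC := if L.2 then .atom L.1 else .neg (.atom L.1)

def TC.iterF : ℕ → TC → TC
  | 0, C => C
  | k + 1, C => .nextF (TC.iterF k C)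

def TC.iterP : ℕ → TC → TC
  | 0, C => C
  | k + 1, C => .nextP (TC.iterP k C)

/-- `○^k C`: `k` occurrences of ○F if `k > 0`, of ○P if `k < 0`. -/
def TC.shift (k : ℤ) (C : TC) : TC :=
  if 0 ≤ k then TC.iterF k.toNat C else TC.iterP (-k).toNat C

/-- `(L₁,n₁) ⇝ (L₂,n₂)`: in every model of `O`,
`(○^{n₁} L₁)^M ⊆ (○^{n₂} L₂)^M`. -/
def leadsTo (O : Ontology) (L₁ : Lit) (n₁ : ℤ) (L₂ : Lit) (n₂ : ℤ) : Prop :=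
  ∀ M : Itp, (∀ cl ∈ O, cl.holds M) →
    TC.sem M (TC.shift n₁ L₁.toTC) ⊆ TC.sem M (TC.shift n₂ L₂.toTC)

/-! ### Soundness of the closure -/

/-- The closure atoms that are true in the interpretation `M`. -/
def trueAtoms (M : Itp) : Set EAtom :=
  {e | ∃ C n, e = EAtom.conc C n ∧ n ∈ TC.sem M C}

theorem conc_mem_trueAtoms {M : Itp} {C : TC} {n : ℤ} :
    EAtom.conc C n ∈ trueAtoms M ↔ n ∈ TC.sem M C := by
  simp [trueAtoms]

theorem clStep_subset_trueAtoms {O : Ontology} {M : Itp} (hM : ∀ cl ∈ O, cl.holds M)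
    {Λ : Set EAtom} (h : Λ ⊆ trueAtoms M) : clStep O Λ ⊆ trueAtoms M := by
  have hΛ : ∀ {C n}, EAtom.conc C n ∈ Λ → n ∈ TC.sem M C :=
    fun hC => conc_mem_trueAtoms.1 (h hC)
  rintro e (((((((((he | ⟨cl, hcl, n, hp, hc⟩) | ⟨C, n, k, hnk, hC, rfl⟩) | ⟨C, n, hC, rfl⟩) |
    ⟨C, n, hC, rfl⟩) | ⟨C, n, hC, rfl⟩) | ⟨C, n, k, hnk, hC, rfl⟩) | ⟨C, n, hC, rfl⟩) |
    ⟨C, n, hC, rfl⟩) | ⟨C, n, hC, rfl⟩)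
  · exact h he
  · obtain ⟨D, hD, hn⟩ := hM cl hcl n fun C hC => hΛ (hp C hC)
    rcases hc with ⟨C, hcC, rfl⟩ | ⟨hc, rfl⟩
    · rw [hcC, List.mem_singleton] at hD
      subst hD
      exact conc_mem_trueAtoms.2 hn
    · simp [hc] at hD
  · exact conc_mem_trueAtoms.2 (hΛ hC k hnk)
  · exact conc_mem_trueAtoms.2 fun k hk => hΛ (hC k hk)
  · exact conc_mem_trueAtoms.2 (show n + 1 ∈ TC.sem M C from hΛ (C := .nextF C) hC)
  · exact conc_mem_trueAtoms.2 (show n ∈ TC.sem M (.nextF C) from hΛ (C := C) hC)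
  · exact conc_mem_trueAtoms.2 (hΛ hC k hnk)
  · exact conc_mem_trueAtoms.2 fun k hk => hΛ (hC k hk)
  · exact conc_mem_trueAtoms.2 (show n - 1 ∈ TC.sem M C from hΛ (C := .nextP C) hC)
  · exact conc_mem_trueAtoms.2 (show n ∈ TC.sem M (.nextP C) from hΛ (C := C) hC)

theorem clIter_subset_trueAtoms {O : Ontology} {M : Itp} (hM : ∀ cl ∈ O, cl.holds M)
    {Λ : Set EAtom} (h : Λ ⊆ trueAtoms M) (o : Ordinal.{0}) :
    clIter O Λ o ⊆ trueAtoms M := by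
  induction o using Ordinal.limitRecOn with
  | zero => simpa [clIter] using h
  | add_one o ih =>
    have := clStep_subset_trueAtoms hM ih
    simpa [clIter] using this
  | limit o ho ih =>
    rw [clIter, Ordinal.limitRecOn_limit _ _ _ _ ho]
    exact Set.iUnion_subset fun o' => Set.iUnion_subset fun h' => ih o' h'

/-- The canonical model is contained in every model. -/
theorem canonItp_subset {O : Ontology} {A : DataInstance} {M : Itp} (hM : IsModel M O A)
    (a : ℕ) : canonItp O A a ⊆ M a := by
  intro n hn
  refine conc_mem_trueAtoms.1 (clIter_subset_trueAtoms hM.1 ?_ _ hn)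
  rintro e ⟨q, hq, rfl⟩
  exact conc_mem_trueAtoms.2 (hM.2 q hq)

/-! ### Atomic concepts outside the ontology -/

theorem TC.sem_congr {M M' : Itp} {C : TC} (h : ∀ a ∈ C.atoms, M a = M' a) :
    TC.sem M C = TC.sem M' C := by
  induction C <;> simp_all [TC.atoms, TC.sem]

theorem TC.atom_mem_subs {C : TC} {a : ℕ} (h : a ∈ C.atoms) : TC.atom a ∈ C.subs := by
  induction C <;> simp_all [TC.atoms, TC.subs] <;> tauto

theorem Ontology.atom_mem_subs {O : Ontology} {a : ℕ} (h : O.occurs a) :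
    TC.atom a ∈ O.subs := by
  obtain ⟨cl, hcl, ⟨C, hC, ha⟩ | ⟨C, hC, ha⟩⟩ := h
  · exact ⟨cl, hcl, C, .inl hC, TC.atom_mem_subs ha⟩
  · exact ⟨cl, hcl, C, .inr hC, TC.atom_mem_subs ha⟩

/-- An atomic concept that does not occur in the ontology holds in the canonical model
only where the data instance says so. -/
theorem mem_atoms_of_mem_canonItp {O : Ontology} {A : DataInstance} (hA : ConsistentWith O A)
    {a : ℕ} (ha : ¬ O.occurs a) {n : ℤ} (hn : n ∈ canonItp O A a) : (a, n) ∈ A.atoms := by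
  classical
  obtain ⟨M, hM, hMA⟩ := hA
  let M' : Itp := fun b => if O.occurs b then M b else A.itp b
  have hsem : ∀ C : TC, (∀ b ∈ C.atoms, O.occurs b) → TC.sem M' C = TC.sem M C :=
    fun C hC => TC.sem_congr fun b hb => if_pos (hC b hb)
  have hM' : IsModel M' O A := by
    refine ⟨fun cl hcl n hp => ?_, fun q hq => ?_⟩
    · obtain ⟨C, hC, hn⟩ := hM cl hcl n fun C hC => by
        rw [← hsem C fun b hb => ⟨cl, hcl, .inl ⟨C, hC, hb⟩⟩]
        exact hp C hC
      refine ⟨C, hC, ?_⟩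
      rwa [hsem C fun b hb => ⟨cl, hcl, .inr ⟨C, hC, hb⟩⟩]
    · change q.2 ∈ if O.occurs q.1 then M q.1 else A.itp q.1
      split_ifs
      · exact hMA q hq
      · exact hq
  have h := canonItp_subset hM' a hn
  simp only [M', if_neg ha] at h
  exact h

theorem mem_canonItp_iff_of_tau_eq {O : Ontology} {A : DataInstance} {a : ℕ}
    (ha : O.occurs a) {m n : ℤ} (h : tau O A m = tau O A n) :
    m ∈ canonItp O A a ↔ n ∈ canonItp O A a := by
  have h' := Set.ext_iff.1 h (.atom a)
  simpa [tau, Ontology.atom_mem_subs ha, TC.sem] using h'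

theorem DataInstance.le_maxT {A : DataInstance} {a : ℕ} {n : ℤ} (h : (a, n) ∈ A.atoms) :
    n ≤ A.maxT :=
  Finset.le_max' _ _ (Finset.mem_image_of_mem Prod.snd h)

theorem DataInstance.minT_le {A : DataInstance} {a : ℕ} {n : ℤ} (h : (a, n) ∈ A.atoms) :
    A.minT ≤ n :=
  Finset.min'_le _ _ (Finset.mem_image_of_mem Prod.snd h)

/-! ### Eventually periodic sets of integers -/

/-- From `N` on, the set `S` is periodic with period `p`. -/
def PeriodicFrom (N : ℤ) (p : ℕ) (S : Set ℤ) : Prop :=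
  ∀ n, N ≤ n → (n ∈ S ↔ n + (p : ℤ) ∈ S)

namespace PeriodicFrom

variable {N N' : ℤ} {p : ℕ} {S T : Set ℤ}

theorem mono (h : PeriodicFrom N p S) (hN : N ≤ N') : PeriodicFrom N' p S :=
  fun n hn => h n (hN.trans hn)

/-- A set containing one full period contains everything after it. -/
theorem mem_of_forall_mem (h : PeriodicFrom N p S) (hp : 0 < p)
    (hS : ∀ m, N ≤ m → m < N + p → m ∈ S) {m : ℤ} (hm : N ≤ m) : m ∈ S := by
  obtain ⟨k, rfl⟩ := Int.le.dest hm
  clear hm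
  induction k using Nat.strong_induction_on with
  | _ k ih =>
    rcases lt_or_ge k p with hk | hk
    · exact hS _ (by omega) (by omega)
    · have := (h _ (by omega)).1 (ih (k - p) (by omega))
      rwa [show N + ((k - p : ℕ) : ℤ) + p = N + k by omega] at this

theorem inter (hS : PeriodicFrom N p S) (hT : PeriodicFrom N p T) :
    PeriodicFrom N p (S ∩ T) :=
  fun n hn => and_congr (hS n hn) (hT n hn)

theorem union (hS : PeriodicFrom N p S) (hT : PeriodicFrom N p T) :
    PeriodicFrom N p (S ∪ T) :=
  fun n hn => or_congr (hS n hn) (hT n hn)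

theorem nextF (hS : PeriodicFrom N p S) : PeriodicFrom N p {n | n + 1 ∈ S} := by
  intro n hn
  have := hS (n + 1) (by omega)
  rwa [show n + 1 + (p : ℤ) = n + p + 1 by omega] at this

theorem nextP (hS : PeriodicFrom N p S) : PeriodicFrom (N + 1) p {n | n - 1 ∈ S} := by
  intro n hn
  have := hS (n - 1) (by omega)
  rwa [show n - 1 + (p : ℤ) = n + p - 1 by omega] at this

theorem untl (hS : PeriodicFrom N p S) (hT : PeriodicFrom N p T) :
    PeriodicFrom N p {n | ∃ k, n < k ∧ k ∈ T ∧ ∀ m, n < m → m < k → m ∈ S} := by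
  intro n hn
  constructor
  · rintro ⟨k, hk, hkT, h⟩
    refine ⟨k + p, by omega, (hT k (by omega)).1 hkT, fun m hm hmk => ?_⟩
    have := (hS (m - p) (by omega)).1 (h _ (by omega) (by omega))
    rwa [sub_add_cancel] at this
  · rintro ⟨k, hk, hkT, h⟩
    refine ⟨k - p, by omega, (hT (k - p) (by omega)).2 (by rwa [sub_add_cancel]),
      fun m hm hmk => (hS m (by omega)).2 (h _ (by omega) (by omega))⟩

theorem since (hp : 0 < p) (hS : PeriodicFrom N p S) (hT : PeriodicFrom N p T) :
    PeriodicFrom (N + p) p {n | ∃ k, k < n ∧ k ∈ T ∧ ∀ m, k < m → m < n → m ∈ S} := by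
  intro n hn
  constructor
  · rintro ⟨k, hk, hkT, h⟩
    rcases lt_or_ge k N with hkN | hkN
    · refine ⟨k, by omega, hkT, fun m hm hmn => ?_⟩
      rcases lt_or_ge m n with hm' | hm'
      · exact h m hm hm'
      · exact hS.mem_of_forall_mem hp (fun m h₁ h₂ => h m (by omega) (by omega)) (by omega)
    · refine ⟨k + p, by omega, (hT k hkN).1 hkT, fun m hm hmk => ?_⟩
      have := (hS (m - p) (by omega)).1 (h _ (by omega) (by omega))
      rwa [sub_add_cancel] at this
  · rintro ⟨k, hk, hkT, h⟩
    rcases lt_or_ge k (N + p) with hkN | hkN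
    · exact ⟨k, by omega, hkT, fun m hm hmn => h m hm (by omega)⟩
    · exact ⟨k - p, by omega, (hT (k - p) (by omega)).2 (by rwa [sub_add_cancel]),
        fun m hm hmk => (hS m (by omega)).2 (h _ (by omega) (by omega))⟩

theorem diamF (hS : PeriodicFrom N p S) : PeriodicFrom N p {n | ∃ k, n < k ∧ k ∈ S} := by
  simpa using untl (S := Set.univ) (fun _ _ => Iff.rfl) hS

theorem diamP (hp : 0 < p) (hS : PeriodicFrom N p S) :
    PeriodicFrom (N + p) p {n | ∃ k, k < n ∧ k ∈ S} := by
  simpa using since (S := Set.univ) hp (fun _ _ => Iff.rfl) hS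

theorem compl (hS : PeriodicFrom N p S) : PeriodicFrom N p Sᶜ :=
  fun n hn => not_congr (hS n hn)

theorem boxF (hS : PeriodicFrom N p S) : PeriodicFrom N p {n | ∀ k, n < k → k ∈ S} := by
  simpa [Set.compl_ofPred] using hS.compl.diamF.compl

theorem boxP (hp : 0 < p) (hS : PeriodicFrom N p S) :
    PeriodicFrom (N + p) p {n | ∀ k, k < n → k ∈ S} := by
  simpa [Set.compl_ofPred] using (hS.compl.diamP hp).compl

end PeriodicFrom

theorem TC.periodicFrom_sem {M : Itp} {N : ℤ} {p : ℕ} (hp : 0 < p)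
    (hM : ∀ a, PeriodicFrom N p (M a)) (C : TC) :
    PeriodicFrom (N + (C.tempOps : ℤ) * p) p (TC.sem M C) := by
  have mono : ∀ {S : Set ℤ} {k : ℕ} (l : ℕ), PeriodicFrom (N + (k : ℤ) * p) p S →
      k ≤ l → PeriodicFrom (N + (l : ℤ) * p) p S :=
    fun l h hkl => h.mono (by gcongr)
  have step : ∀ k : ℕ, N + ((k + 1 : ℕ) : ℤ) * p = N + (k : ℤ) * p + p := fun k => by
    push_cast
    ring
  induction C with
  | top => exact fun _ _ => Iff.rfl
  | atom a => exact (hM a).mono (by simp [TC.tempOps])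
  | neg C ih => exact ih.compl
  | and C D ihC ihD =>
    exact (mono _ ihC (Nat.le_add_right _ _)).inter (mono _ ihD (Nat.le_add_left _ _))
  | or C D ihC ihD =>
    exact (mono _ ihC (Nat.le_add_right _ _)).union (mono _ ihD (Nat.le_add_left _ _))
  | nextF C ih => exact mono _ ih.nextF (Nat.le_succ _)
  | diamF C ih => exact mono _ ih.diamF (Nat.le_succ _)
  | boxF C ih => exact mono _ ih.boxF (Nat.le_succ _)
  | untl C D ihC ihD =>
    exact mono _ ((mono _ ihC (Nat.le_add_right _ _)).untl (mono _ ihD (Nat.le_add_left _ _)))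
      (Nat.le_succ _)
  | nextP C ih =>
    rw [TC.tempOps, step]
    exact ih.nextP.mono (by omega)
  | diamP C ih =>
    rw [TC.tempOps, step]
    exact ih.diamP hp
  | boxP C ih =>
    rw [TC.tempOps, step]
    exact ih.boxP hp
  | since C D ihC ihD =>
    rw [TC.tempOps, step]
    exact (mono _ ihC (Nat.le_add_right _ _)).since hp (mono _ ihD (Nat.le_add_left _ _))

/-! ### Time reversal -/

/-- The temporal concept with future and past interchanged. -/
def TC.mirror : TC → TC
  | .top => .top
  | .atom a => .atom a
  | .neg C => .neg C.mirror
  | .and C D => .and C.mirror D.mirror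
  | .or C D => .or C.mirror D.mirror
  | .nextF C => .nextP C.mirror
  | .diamF C => .diamP C.mirror
  | .boxF C => .boxP C.mirror
  | .untl C D => .since C.mirror D.mirror
  | .nextP C => .nextF C.mirror
  | .diamP C => .diamF C.mirror
  | .boxP C => .boxF C.mirror
  | .since C D => .untl C.mirror D.mirror

theorem TC.tempOps_mirror (C : TC) : C.mirror.tempOps = C.tempOps := by
  induction C <;> simp_all [TC.mirror, TC.tempOps]

theorem TC.mem_sem_mirror {M : Itp} {C : TC} {n : ℤ} :
    n ∈ TC.sem (fun a => {m | -m ∈ M a}) C.mirror ↔ -n ∈ TC.sem M C := by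
  have ex_neg : ∀ {P : ℤ → Prop}, (∃ k, P (-k)) ↔ ∃ k, P k :=
    fun {_} => (Equiv.neg ℤ).exists_congr_left.symm
  have all_neg : ∀ {P : ℤ → Prop}, (∀ k, P (-k)) ↔ ∀ k, P k :=
    fun {_} => (Equiv.neg ℤ).forall_congr_left.symm
  induction C generalizing n with
  | top => exact Iff.rfl
  | atom a => exact Iff.rfl
  | neg C ih => exact not_congr ih
  | and C D ihC ihD => exact and_congr ihC ihD
  | or C D ihC ihD => exact or_congr ihC ihD
  | nextF C ih => simp [TC.mirror, TC.sem, ih, add_comm, sub_eq_add_neg]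
  | nextP C ih => simp [TC.mirror, TC.sem, ih, add_comm, sub_eq_add_neg]
  | diamF C ih =>
    simp only [TC.mirror, TC.sem, Set.mem_ofPred_eq, ih]
    rw [← ex_neg]
    simp [neg_lt]
  | diamP C ih =>
    simp only [TC.mirror, TC.sem, Set.mem_ofPred_eq, ih]
    rw [← ex_neg]
    simp [lt_neg]
  | boxF C ih =>
    simp only [TC.mirror, TC.sem, Set.mem_ofPred_eq, ih]
    rw [← all_neg]
    simp [neg_lt]
  | boxP C ih =>
    simp only [TC.mirror, TC.sem, Set.mem_ofPred_eq, ih]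
    rw [← all_neg]
    simp [lt_neg]
  | untl C D ihC ihD =>
    simp only [TC.mirror, TC.sem, Set.mem_ofPred_eq, ihC, ihD]
    rw [← ex_neg]
    refine exists_congr fun k => and_congr neg_lt (and_congr (by simp) ?_)
    rw [← all_neg]
    refine forall_congr' fun m => ?_
    simp only [neg_neg, neg_lt_neg_iff, neg_lt]
    tauto
  | since C D ihC ihD =>
    simp only [TC.mirror, TC.sem, Set.mem_ofPred_eq, ihC, ihD]
    rw [← ex_neg]
    refine exists_congr fun k => and_congr lt_neg (and_congr (by simp) ?_)
    rw [← all_neg]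
    refine forall_congr' fun m => ?_
    simp only [neg_neg, neg_lt_neg_iff, lt_neg]
    tauto

/-- periodicity of positive temporal concepts in the
canonical model, beyond the prefix `s_O + l_κ · p_O`. -/
theorem positive_concept_periodic (O : Ontology) (hO : O.HornBoxNext)
    (s p : ℕ) (hs : 0 < s) (hp : 0 < p)
    (hper : ∀ A : DataInstance, ConsistentWith O A →
        (∀ n : ℤ, n ≤ A.minT - (s : ℤ) → tau O A n = tau O A (n - (p : ℤ))) ∧
        (∀ n : ℤ, A.maxT + (s : ℤ) ≤ n → tau O A n = tau O A (n + (p : ℤ))))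
    (A : DataInstance) (hA : ConsistentWith O A) (κ : TC) (hκ : κ.IsPositive) :
    (∀ n : ℤ, A.maxT + (s : ℤ) + (κ.tempOps : ℤ) * (p : ℤ) ≤ n →
        (n ∈ TC.sem (canonItp O A) κ ↔ n + (p : ℤ) ∈ TC.sem (canonItp O A) κ)) ∧
    (∀ n : ℤ, n ≤ A.minT - ((s : ℤ) + (κ.tempOps : ℤ) * (p : ℤ)) →
        (n ∈ TC.sem (canonItp O A) κ ↔ n - (p : ℤ) ∈ TC.sem (canonItp O A) κ)) := by
  obtain ⟨hpast, hfut⟩ := hper A hA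
  refine ⟨TC.periodicFrom_sem hp (fun a n hn => ?_) κ, fun n hn => ?_⟩
  · by_cases ha : O.occurs a
    · exact mem_canonItp_iff_of_tau_eq ha (hfut n hn)
    · refine iff_of_false (fun h => ?_) fun h => ?_ <;>
        have := DataInstance.le_maxT (mem_atoms_of_mem_canonItp hA ha h) <;> omega
  · have hM : ∀ a, PeriodicFrom (s - A.minT) p {m | -m ∈ canonItp O A a} := by
      intro a m hm
      change -m ∈ canonItp O A a ↔ -(m + (p : ℤ)) ∈ canonItp O A a
      by_cases ha : O.occurs a
      · rw [neg_add']
        exact mem_canonItp_iff_of_tau_eq ha (hpast (-m) (by omega))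
      · refine iff_of_false (fun h => ?_) fun h => ?_ <;>
          have := DataInstance.minT_le (mem_atoms_of_mem_canonItp hA ha h) <;> omega
    have h := TC.periodicFrom_sem hp hM κ.mirror (-n) (by rw [TC.tempOps_mirror]; omega)
    rwa [TC.mem_sem_mirror, TC.mem_sem_mirror, neg_add', neg_neg] at h

end LTLOMQ
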